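/- Let n and r be positive integers. In ℤ[x] one has the identity Σ_{w ∈ S(n,r)} x^{asc(w)} = Σ_{i=0}^{⌊n/2⌋} ξ_{n,r,i} · x^i (1+x)^{n−2i}, where ξ_{n,r,i} is the number of words w ∈ S(n,r) with exactly i ascents that have the matching property. -/

import Mathlib

open scoped Classical

noncomputable section

/-- Value of a word `w : Fin (n+1) → ℕ` at a natural index (junk value `0` out of range). -/
def wv {n : ℕ} (w : Fin (n + 1) → ℕ) (k : ℕ) : ℕ :=
  if h : k < n + 1 then w ⟨k, h⟩ else 0

/-- The number of ascents of a word `w = (w_0, w_1, …, w_n)`, i.e. the number of indices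
`i ∈ {0,…,n-1}` with `w_i < w_{i+1}`. -/
def asc {n : ℕ} (w : Fin (n + 1) → ℕ) : ℕ :=
  ((Finset.range n).filter fun i => wv w i < wv w (i + 1)).card

/-- The set `S(n,r)` of Smirnov words `w = (w_0, …, w_n) ∈ {0,…,r-1}^{n+1}` with
`w_0 = w_n = 0` and no two consecutive entries equal. -/
def smirnov (n r : ℕ) : Finset (Fin (n + 1) → ℕ) :=
  (Fintype.piFinset fun _ => Finset.range r).filter fun w =>
    wv w 0 = 0 ∧ wv w n = 0 ∧ ∀ i < n, wv w i ≠ wv w (i + 1)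

/-- `k ∈ {1,…,n-1}` is a double ascent of `w` if `w_{k-1} < w_k < w_{k+1}`. -/
def doubleAscent {n : ℕ} (w : Fin (n + 1) → ℕ) (k : ℕ) : Prop :=
  1 ≤ k ∧ k < n ∧ wv w (k - 1) < wv w k ∧ wv w k < wv w (k + 1)

/-- `k ∈ {1,…,n-1}` is a double descent of `w` if `w_{k-1} > w_k > w_{k+1}`. -/
def doubleDescent {n : ℕ} (w : Fin (n + 1) → ℕ) (k : ℕ) : Prop :=
  1 ≤ k ∧ k < n ∧ wv w k < wv w (k - 1) ∧ wv w (k + 1) < wv w k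

/-- `w` has the matching property: for every double ascent `k` of `w` there is a double
descent `ℓ > k` with `w_k = w_ℓ` and `w_k ≤ w_j` for all `k < j < ℓ`. -/
def hasMatching {n : ℕ} (w : Fin (n + 1) → ℕ) : Prop :=
  ∀ k, doubleAscent w k →
    ∃ l, k < l ∧ doubleDescent w l ∧ wv w k = wv w l ∧
      ∀ j, k < j → j < l → wv w k ≤ wv w j

section Transducer

variable {σ R : Type*} [CommRing R]

/-- Weight of the walk `w i, w (i+1), …, w (i+m)` read by a transducer with step weights `τ` and
transitions `δ`; only walks ending at `0` have nonzero weight. -/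
def pathWeight (τ : σ → ℕ → ℕ → R) (δ : σ → ℕ → ℕ → σ) (w : ℕ → ℕ) : ℕ → ℕ → σ → R
  | 0, i, _ => if w i = 0 then 1 else 0
  | m + 1, i, q => τ q (w i) (w (i + 1)) * pathWeight τ δ w m (i + 1) (δ q (w i) (w (i + 1)))

/-- Total weight of the walks with `m` steps and letters below `r` starting at `p`. -/
def pathSum (τ : σ → ℕ → ℕ → R) (δ : σ → ℕ → ℕ → σ) (r : ℕ) : ℕ → σ → ℕ → R
  | 0, _, p => if p = 0 then 1 else 0
  | m + 1, q, p => ∑ u ∈ Finset.range r, τ q p u * pathSum τ δ r m (δ q p u) u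

/-- Generating function of `pathSum` by number of steps. -/
def pathSeries (τ : σ → ℕ → ℕ → R) (δ : σ → ℕ → ℕ → σ) (r : ℕ) (q : σ) (p : ℕ) : PowerSeries R :=
  PowerSeries.mk fun m => pathSum τ δ r m q p

theorem pathSeries_eq (τ : σ → ℕ → ℕ → R) (δ : σ → ℕ → ℕ → σ) (r : ℕ) (q : σ) (p : ℕ) :
    pathSeries τ δ r q p = (if p = 0 then 1 else 0) + ∑ u ∈ Finset.range r,
      PowerSeries.C (τ q p u) * (PowerSeries.X * pathSeries τ δ r (δ q p u) u) := by
  ext m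
  cases m with
  | zero =>
    simp only [pathSeries, PowerSeries.coeff_mk, pathSum, map_add, map_sum,
      PowerSeries.coeff_C_mul, PowerSeries.coeff_zero_X_mul, mul_zero, Finset.sum_const_zero,
      add_zero]
    split_ifs <;> simp
  | succ m =>
    simp only [pathSeries, PowerSeries.coeff_mk, pathSum, map_add, map_sum,
      PowerSeries.coeff_C_mul, PowerSeries.coeff_succ_X_mul]
    split_ifs <;> simp [PowerSeries.coeff_one]

theorem pathWeight_congr_shift (τ : σ → ℕ → ℕ → R) (δ : σ → ℕ → ℕ → σ) {v w : ℕ → ℕ}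
    (h : ∀ k, v (k + 1) = w k) (m i : ℕ) (q : σ) :
    pathWeight τ δ v m (i + 1) q = pathWeight τ δ w m i q := by
  induction m generalizing i q with
  | zero => simp [pathWeight, h]
  | succ m ih => simp only [pathWeight, h, ih]

theorem pathWeight_eq_zero (τ : σ → ℕ → ℕ → R) (δ : σ → ℕ → ℕ → σ) (hτ : ∀ q p, τ q p p = 0)
    (w : ℕ → ℕ) (m i : ℕ) (q : σ)
    (h : ¬ (w (i + m) = 0 ∧ ∀ j < m, w (i + j) ≠ w (i + j + 1))) :
    pathWeight τ δ w m i q = 0 := by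
  induction m generalizing i q with
  | zero =>
    rw [pathWeight, if_neg]
    simpa using h
  | succ m ih =>
    rw [pathWeight]
    by_cases h0 : w i = w (i + 1)
    · rw [← h0, hτ, zero_mul]
    · rw [ih, mul_zero]
      rintro ⟨h1, h2⟩
      refine h ⟨by rw [← h1]; congr 1; omega, fun j hj => ?_⟩
      cases j with
      | zero => simpa using h0
      | succ j =>
        have := h2 j (by omega)
        rwa [show i + 1 + j = i + (j + 1) by omega] at this

theorem wv_cons_zero {n : ℕ} (p : ℕ) (w : Fin (n + 1) → ℕ) :
    wv (Fin.cons p w : Fin (n + 2) → ℕ) 0 = p := by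
  simp [wv]

theorem wv_cons_succ {n : ℕ} (p : ℕ) (w : Fin (n + 1) → ℕ) (k : ℕ) :
    wv (Fin.cons p w : Fin (n + 2) → ℕ) (k + 1) = wv w k := by
  unfold wv
  by_cases h : k < n + 1
  · rw [dif_pos h, dif_pos (by omega)]
    exact Fin.cons_succ (α := fun _ => ℕ) p w ⟨k, h⟩
  · rw [dif_neg h, dif_neg (by omega)]

theorem sum_pathWeight (τ : σ → ℕ → ℕ → R) (δ : σ → ℕ → ℕ → σ) {r : ℕ} (n : ℕ) (q : σ) {p : ℕ}
    (hp : p < r) :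
    ∑ w ∈ (Fintype.piFinset fun _ : Fin (n + 1) => Finset.range r).filter (fun w => wv w 0 = p),
      pathWeight τ δ (wv w) n 0 q = pathSum τ δ r n q p := by
  induction n generalizing q p with
  | zero =>
    rw [Finset.sum_eq_single (fun _ => p)]
    · simp [pathWeight, pathSum, wv]
    · intro w hw hne
      refine absurd ?_ hne
      funext j
      rw [Fin.fin_one_eq_zero j]
      simpa [wv] using (Finset.mem_filter.1 hw).2
    · intro h
      simp [wv, hp] at h
  | succ n ih =>
    have key : ∀ u ∈ Finset.range r, τ q p u * pathSum τ δ r n (δ q p u) u =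
        ∑ w ∈ ((Fintype.piFinset fun _ : Fin (n + 1) => Finset.range r).filter
          (fun w => wv w 0 = u)), pathWeight τ δ (wv (Fin.cons p w : Fin (n + 2) → ℕ)) (n + 1) 0 q := by
      intro u hu
      rw [← ih _ (Finset.mem_range.1 hu), Finset.mul_sum]
      refine Finset.sum_congr rfl fun w hw => ?_
      rw [pathWeight, wv_cons_zero, wv_cons_succ, (Finset.mem_filter.1 hw).2,
        pathWeight_congr_shift τ δ (wv_cons_succ p w)]
    rw [pathSum, Finset.sum_congr rfl key, Finset.sum_fiberwise_of_maps_to]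
    · symm
      refine Finset.sum_bij (fun w _ => (Fin.cons p w : Fin (n + 2) → ℕ)) ?_ ?_ ?_ ?_
      · intro w hw
        rw [Finset.mem_filter, Fintype.mem_piFinset]
        refine ⟨fun j => ?_, wv_cons_zero p w⟩
        refine Fin.cases ?_ (fun j => ?_) j
        · simpa using hp
        · simpa using Fintype.mem_piFinset.1 hw j
      · intro w _ w' _ h
        exact (Fin.cons_injective2 (α := fun _ => ℕ) h).2
      · intro w hw
        rw [Finset.mem_filter, Fintype.mem_piFinset] at hw
        refine ⟨Fin.tail w, Fintype.mem_piFinset.2 fun j => hw.1 _, ?_⟩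
        have h0 : w 0 = p := by simpa [wv] using hw.2
        rw [← h0]
        exact Fin.cons_self_tail w
      · intro w _
        rfl
    · intro w hw
      have := Fintype.mem_piFinset.1 hw 0
      simpa [wv] using this

end Transducer

section Recurrence

variable {R : Type*} [CommRing R]

theorem PowerSeries.eq_zero_of_forall_X_pow_dvd {y : PowerSeries R}
    (h : ∀ n, (PowerSeries.X : PowerSeries R) ^ n ∣ y) : y = 0 := by
  ext n
  simpa using PowerSeries.X_pow_dvd_iff.1 (h (n + 1)) n (Nat.lt_succ_self n)

theorem PowerSeries.isUnit_one_add_X : IsUnit (1 + PowerSeries.X : PowerSeries R) := by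
  rw [PowerSeries.isUnit_iff_constantCoeff]
  simp

/-- Factor contributed by the closing of a level, according to whether it was opened by a double
ascent. -/
def closingFactor (x : R) (b : Prop) : PowerSeries R :=
  if b then PowerSeries.X else 1 + (1 + PowerSeries.C x) * PowerSeries.X

/-- Product of the closing factors of the levels `1, …, h`. -/
def closingProd (x : R) (A : Finset ℕ) (h : ℕ) : PowerSeries R :=
  ∏ a ∈ Finset.range h, closingFactor x (a + 1 ∈ A)

theorem closingProd_congr (x : R) {A B : Finset ℕ} {h : ℕ} (hAB : ∀ a ≤ h, a ∈ A ↔ a ∈ B) :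
    closingProd x A h = closingProd x B h := by
  refine Finset.prod_congr rfl fun a ha => ?_
  rw [hAB (a + 1) (by simpa using ha)]

theorem closingProd_succ (x : R) (A : Finset ℕ) (h : ℕ) :
    closingProd x A (h + 1) = closingProd x A h * closingFactor x (h + 1 ∈ A) :=
  Finset.prod_range_succ _ _

/-- Each open level is closed exactly once, so the dependence of a continuation on the set `A` of
open levels is multiplicative. -/
theorem open_levels_factor (x : R) (r : ℕ) (FU FD : ℕ → PowerSeries R)
    (GU GD : Finset ℕ → ℕ → PowerSeries R)
    (hFU : ∀ h, h + 1 < r → FU h = (1 + PowerSeries.C x * PowerSeries.X) * FU (h + 1) +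
      PowerSeries.C x * PowerSeries.X * FD h)
    (hFU0 : ∀ h, r ≤ h + 1 → FU h = 0)
    (hFD0 : FD 0 = PowerSeries.X * (1 + FU 0))
    (hFD : ∀ h, h + 1 < r → FD (h + 1) =
      PowerSeries.X * FU (h + 1) + (1 + PowerSeries.X) * FD h)
    (hGU : ∀ A h, h + 1 < r → (∀ a ∈ A, a ≤ h) →
      GU A h = PowerSeries.C x * PowerSeries.X * (GU (insert (h + 1) A) (h + 1) + GD A h) +
        GU A (h + 1))
    (hGU0 : ∀ A h, r ≤ h + 1 → GU A h = 0)
    (hGD0 : ∀ A, GD A 0 = PowerSeries.X * (1 + GU (A.filter (· ≤ 0)) 0))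
    (hGD : ∀ A h, h + 1 < r → GD A (h + 1) =
      PowerSeries.X * GU (A.filter (· ≤ h + 1)) (h + 1) + closingFactor x (h + 1 ∈ A) * GD A h)
    (A : Finset ℕ) (h : ℕ) (hA : ∀ a ∈ A, a ≤ h) :
    (1 + PowerSeries.X) ^ h * GU A h = closingProd x A h * FU h := by
  have main : ∀ n : ℕ,
      (∀ A h, (∀ a ∈ A, a ≤ h) → (PowerSeries.X : PowerSeries R) ^ n ∣
        (1 + PowerSeries.X) ^ h * GU A h - closingProd x A h * FU h) ∧
      (∀ A h, h < r → (PowerSeries.X : PowerSeries R) ^ n ∣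
        (1 + PowerSeries.X) ^ h * GD A h - closingProd x A h * FD h) := by
    intro n
    induction n with
    | zero => simp
    | succ n ih =>
      obtain ⟨ihU, ihD⟩ := ih
      have mulX : ∀ {y : PowerSeries R}, PowerSeries.X ^ n ∣ y →
          PowerSeries.X ^ (n + 1) ∣ PowerSeries.X * y := by
        intro y hy
        rw [pow_succ']
        exact mul_dvd_mul_left _ hy
      constructor
      · intro A h hA
        induction hk : r - (h + 1) generalizing A h with
        | zero => simp [hGU0 A h (by omega), hFU0 h (by omega)]
        | succ k ihk =>
          have hr : h + 1 < r := by omega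
          have e1 := ihU (insert (h + 1) A) (h + 1) (by
            intro a ha
            rcases Finset.mem_insert.1 ha with rfl | ha
            · exact le_rfl
            · exact (hA a ha).trans (Nat.le_succ h))
          have e2 := ihk A (h + 1) (fun a ha => (hA a ha).trans (Nat.le_succ h)) (by omega)
          have e3 := ihD A h (by omega)
          have hnot : h + 1 ∉ A := fun hc => absurd (hA _ hc) (by omega)
          have c1 : closingProd x (insert (h + 1) A) (h + 1) =
              closingProd x A h * PowerSeries.X := by
            rw [closingProd_succ, closingProd_congr x (B := A), closingFactor,
              if_pos (Finset.mem_insert_self _ _)]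
            intro a ha
            rw [Finset.mem_insert, or_iff_right (by omega)]
          have c2 : closingProd x A (h + 1) =
              closingProd x A h * (1 + (1 + PowerSeries.C x) * PowerSeries.X) := by
            rw [closingProd_succ, closingFactor, if_neg hnot]
          rw [c1] at e1
          rw [c2] at e2
          rw [← PowerSeries.isUnit_one_add_X.dvd_mul_left, hGU A h hr hA, hFU h hr]
          convert ((mulX e1).mul_left (PowerSeries.C x)).add (e2.add
            ((mulX e3).mul_left (PowerSeries.C x * (1 + PowerSeries.X)))) using 1
          ring
      · intro A h hr
        induction h with
        | zero =>
          have e := mulX (ihU (A.filter (· ≤ 0)) 0 (by simp))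
          rw [hGD0, hFD0]
          convert e using 1
          simp [closingProd]
          ring
        | succ h ihh =>
          have e1 := mulX (ihU (A.filter (· ≤ h + 1)) (h + 1) (by simp))
          have e2 := ihh (by omega)
          rw [closingProd_congr x (B := A) (by simp +contextual), closingProd_succ] at e1
          rw [hGD A h hr, hFD h hr, closingProd_succ]
          convert e1.add (e2.mul_left ((1 + PowerSeries.X) * closingFactor x (h + 1 ∈ A))) using 1
          ring
  exact sub_eq_zero.1 (PowerSeries.eq_zero_of_forall_X_pow_dvd fun n => (main n).1 A h hA)

end Recurrence

section Weights

variable {R : Type*} [CommRing R]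

/-- Step weight counting ascents. -/
def ascStep (x : R) (_ : Unit) (p u : ℕ) : R :=
  if p < u then x else if u < p then 1 else 0

/-- Step weight of the matching transducer. The state consists of the set `A` of levels opened by a
double ascent (entries above the current letter being obsolete), and of whether the current letter
was reached by an ascent. -/
def matchStep (x : R) (q : Finset ℕ × Bool) (p u : ℕ) : R :=
  if p < u then x
  else if u < p ∧ ∀ a ∈ q.1, u < a → p ≤ a then
    if q.2 = true ∨ p ∈ q.1 then 1 else 1 + x
  else 0

/-- Transition of the matching transducer. -/
def matchNext (q : Finset ℕ × Bool) (p u : ℕ) : Finset ℕ × Bool :=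
  if p < u then
    (if q.2 = true then insert p (q.1.filter (· < p)) else q.1.filter (· ≤ p), true)
  else (q.1, false)

theorem sum_ite_le_eq_add {M : Type*} [AddCommMonoid M] {r h : ℕ} (hr : h < r) (f : ℕ → M) :
    (∑ u ∈ Finset.range r, if h ≤ u then f u else 0) =
      f h + ∑ u ∈ Finset.range r, if h + 1 ≤ u then f u else 0 := by
  have : ∀ u ∈ Finset.range r, (if h ≤ u then f u else 0) =
      (if u = h then f u else 0) + if h + 1 ≤ u then f u else 0 := by
    intro u _
    rcases lt_trichotomy u h with hu | rfl | hu
    · simp [hu.not_ge, hu.ne, show ¬ h + 1 ≤ u by omega]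
    · simp
    · simp [hu.le, hu.ne', Nat.succ_le_of_lt hu]
  rw [Finset.sum_congr rfl this, Finset.sum_add_distrib, Finset.sum_ite_eq',
    if_pos (Finset.mem_range.2 hr)]

/-- Continuations of an ascent whose next letter is at least `h`. -/
def upSeries (x : R) (r : ℕ) (S : ℕ → PowerSeries R) (h : ℕ) : PowerSeries R :=
  ∑ u ∈ Finset.range r, if h ≤ u then PowerSeries.C x * PowerSeries.X * S u else 0

theorem upSeries_of_le (x : R) {r : ℕ} (S : ℕ → PowerSeries R) {h : ℕ} (hr : r ≤ h) :
    upSeries x r S h = 0 :=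
  Finset.sum_eq_zero fun u hu => if_neg (by have := Finset.mem_range.1 hu; omega)

theorem upSeries_succ (x : R) {r : ℕ} (S : ℕ → PowerSeries R) {h : ℕ} (hr : h < r) :
    upSeries x r S h = PowerSeries.C x * PowerSeries.X * S h + upSeries x r S (h + 1) :=
  sum_ite_le_eq_add hr _

/-- Continuations of a descent whose next letter is below `h` and which close no level of `A`
strictly between that letter and `h`. -/
def downSeries (A : Finset ℕ) (S : ℕ → PowerSeries R) (h : ℕ) : PowerSeries R :=
  ∑ u ∈ Finset.range h, if ∀ a ∈ A, u < a → h ≤ a then PowerSeries.X * S u else 0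

theorem downSeries_zero (A : Finset ℕ) (S : ℕ → PowerSeries R) : downSeries A S 0 = 0 := by
  simp [downSeries]

theorem downSeries_succ (A : Finset ℕ) (S : ℕ → PowerSeries R) (h : ℕ) :
    downSeries A S (h + 1) =
      PowerSeries.X * S h + (if h ∈ A then 0 else downSeries A S h) := by
  rw [downSeries, Finset.sum_range_succ, add_comm, if_pos (fun _ _ h => Nat.succ_le_of_lt h)]
  congr 1
  split_ifs with hA
  · refine Finset.sum_eq_zero fun u hu => if_neg fun hc => ?_
    exact absurd (hc h hA (Finset.mem_range.1 hu)) (by omega)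
  · refine Finset.sum_congr rfl fun u _ => if_congr ?_ rfl rfl
    refine forall₃_congr fun a ha _ => ?_
    have : a ≠ h := fun hc => hA (hc ▸ ha)
    omega

theorem sum_range_split {M : Type*} [AddCommMonoid M] {r p : ℕ} (hp : p < r) (f g : ℕ → M) :
    (∑ u ∈ Finset.range r, if p < u then f u else if u < p then g u else 0) =
      (∑ u ∈ Finset.range r, if p + 1 ≤ u then f u else 0) + ∑ u ∈ Finset.range p, g u := by
  have h1 : ∑ u ∈ Finset.range p, g u = ∑ u ∈ Finset.range r, if u < p then g u else 0 := by
    rw [← Finset.sum_filter]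
    refine Finset.sum_congr ?_ fun _ _ => rfl
    ext u
    simp only [Finset.mem_range, Finset.mem_filter]
    omega
  rw [h1, ← Finset.sum_add_distrib]
  refine Finset.sum_congr rfl fun u _ => ?_
  rcases lt_trichotomy u p with hu | rfl | hu
  · simp [hu, hu.not_gt, show ¬ p + 1 ≤ u by omega]
  · simp
  · simp [hu, hu.not_gt, Nat.succ_le_of_lt hu]

theorem ascSeries_eq (x : R) {r p : ℕ} (hp : p < r) (δ : Unit → ℕ → ℕ → Unit) :
    pathSeries (ascStep x) δ r () p = (if p = 0 then 1 else 0) +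
      (upSeries x r (pathSeries (ascStep x) δ r ()) (p + 1) +
        downSeries ∅ (pathSeries (ascStep x) δ r ()) p) := by
  rw [pathSeries_eq, upSeries, downSeries, ← sum_range_split hp]
  congr 1
  refine Finset.sum_congr rfl fun u _ => ?_
  unfold ascStep
  split_ifs <;> simp_all [mul_assoc]

theorem matchSeries_eq (x : R) {r p : ℕ} (hp : p < r) (A : Finset ℕ) (d : Bool) :
    pathSeries (matchStep x) matchNext r (A, d) p = (if p = 0 then 1 else 0) +
      (upSeries x r (pathSeries (matchStep x) matchNext r
        (if d = true then insert p (A.filter (· < p)) else A.filter (· ≤ p), true)) (p + 1) +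
      (if d = true ∨ p ∈ A then 1 else 1 + PowerSeries.C x) *
        downSeries A (pathSeries (matchStep x) matchNext r (A, false)) p) := by
  rw [pathSeries_eq, upSeries, downSeries, Finset.mul_sum, ← sum_range_split hp]
  congr 1
  refine Finset.sum_congr rfl fun u _ => ?_
  unfold matchStep matchNext
  rcases lt_trichotomy u p with hu | rfl | hu
  · simp only [hu.not_gt, hu, if_false, true_and, if_true]
    split_ifs <;> simp
  · simp
  · simp only [hu, if_true]
    ring

theorem matchSeries_zero (x : R) {r : ℕ} (hr : 0 < r) (δ : Unit → ℕ → ℕ → Unit) :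
    pathSeries (matchStep x) matchNext r (∅, false) 0 = pathSeries (ascStep x) δ r () 0 := by
  have key := open_levels_factor x r
    (fun h => upSeries x r (pathSeries (ascStep x) δ r ()) (h + 1))
    (fun h => downSeries ∅ (pathSeries (ascStep x) δ r ()) (h + 1))
    (fun A h => upSeries x r (pathSeries (matchStep x) matchNext r (A, true)) (h + 1))
    (fun A h => downSeries A (pathSeries (matchStep x) matchNext r (A, false)) (h + 1))
    (fun h hh => by
      rw [upSeries_succ x _ hh, ascSeries_eq x hh]
      simp
      ring)
    (fun h hh => upSeries_of_le x _ hh)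
    (by
      simp only [downSeries_succ, downSeries_zero]
      rw [ascSeries_eq x hr]
      simp [downSeries_zero])
    (fun h hh => by
      rw [downSeries_succ _ _ (h + 1), ascSeries_eq x hh]
      simp
      ring)
    (fun A h hh hA => by
      rw [upSeries_succ x _ hh, matchSeries_eq x hh]
      simp [Finset.filter_true_of_mem hA])
    (fun A h hh => upSeries_of_le x _ hh)
    (fun A => by
      simp only [downSeries_succ, downSeries_zero]
      rw [matchSeries_eq x hr]
      simp [downSeries_zero])
    (fun A h hh => by
      rw [downSeries_succ _ _ (h + 1), matchSeries_eq x hh]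
      by_cases hA : h + 1 ∈ A
      · simp [hA, closingFactor]
        ring
      · simp [hA, closingFactor]
        ring)
    ∅ 0 (by simp)
  rw [matchSeries_eq x hr, ascSeries_eq x hr]
  simp only [pow_zero, one_mul, closingProd, Finset.range_zero, Finset.prod_empty] at key
  simp [downSeries_zero, key]

end Weights

section Words

variable {R : Type*} [CommRing R] {n : ℕ}

/-- Number of ascents of `w` at indices at least `i`. -/
def ascFrom (w : Fin (n + 1) → ℕ) (i : ℕ) : ℕ :=
  ((Finset.Ico i n).filter fun j => wv w j < wv w (j + 1)).card

theorem ascFrom_zero (w : Fin (n + 1) → ℕ) : ascFrom w 0 = asc w := by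
  rw [ascFrom, asc, Finset.range_eq_Ico]

theorem ascFrom_self (w : Fin (n + 1) → ℕ) : ascFrom w n = 0 := by
  simp [ascFrom]

theorem ascFrom_eq (w : Fin (n + 1) → ℕ) {i : ℕ} (hi : i < n) :
    ascFrom w i = (if wv w i < wv w (i + 1) then 1 else 0) + ascFrom w (i + 1) := by
  rw [ascFrom, ascFrom, ← Finset.insert_Ico_add_one_left_eq_Ico hi, Finset.filter_insert]
  split_ifs
  · rw [Finset.card_insert_of_notMem (by simp), add_comm]
  · rw [zero_add]

theorem ascWeight_eq (x : R) (δ : Unit → ℕ → ℕ → Unit) (w : Fin (n + 1) → ℕ) (hn : wv w n = 0)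
    (hw : ∀ i < n, wv w i ≠ wv w (i + 1)) (m i : ℕ) (him : i + m = n) :
    pathWeight (ascStep x) δ (wv w) m i () = x ^ ascFrom w i := by
  induction m generalizing i with
  | zero =>
    obtain rfl : i = n := him
    simp [pathWeight, hn, ascFrom_self]
  | succ m ih =>
    rw [pathWeight, ih (i + 1) (by omega), ascFrom_eq w (i := i) (by omega), ascStep, pow_add]
    have := hw i (by omega)
    split_ifs <;> first | omega | simp

/-- Some double descent at value `a` occurs from index `i` on, before any letter below `a`. -/
def closedFrom (w : Fin (n + 1) → ℕ) (a i : ℕ) : Prop :=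
  ∃ l, i ≤ l ∧ doubleDescent w l ∧ a = wv w l ∧ ∀ j, i ≤ j → j < l → a ≤ wv w j

theorem closedFrom_succ_iff (w : Fin (n + 1) → ℕ) {a i : ℕ} (ha : a ≤ wv w i)
    (hi : ¬ (doubleDescent w i ∧ a = wv w i)) : closedFrom w a i ↔ closedFrom w a (i + 1) := by
  constructor
  · rintro ⟨l, h1, h2, h3, h4⟩
    rcases h1.eq_or_lt with rfl | h1
    · exact absurd ⟨h2, h3⟩ hi
    · exact ⟨l, h1, h2, h3, fun j hj => h4 j (by omega)⟩
  · rintro ⟨l, h1, h2, h3, h4⟩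
    refine ⟨l, by omega, h2, h3, fun j hj hl => ?_⟩
    rcases hj.eq_or_lt with rfl | hj
    · exact ha
    · exact h4 j hj hl

theorem not_closedFrom (w : Fin (n + 1) → ℕ) {a i : ℕ} (h1 : wv w (i + 1) < a)
    (h2 : a < wv w i) : ¬ closedFrom w a i := by
  rintro ⟨l, hl, -, h3, h4⟩
  rcases hl.eq_or_lt with rfl | hl
  · omega
  · rcases (Nat.succ_le_of_lt hl).eq_or_lt with h | hl
    · rw [← h] at h3
      exact absurd h3 h1.ne'
    · exact absurd (h4 (i + 1) (by omega) hl) (by omega)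

/-- The levels of `A` still open at letter `p`. -/
def openLevels (A : Finset ℕ) (d : Bool) (p : ℕ) : Finset ℕ :=
  A.filter fun a => a < p ∨ d = false ∧ a = p

/-- All levels open at index `i`, and all those opened later, get closed. -/
def closesFrom (w : Fin (n + 1) → ℕ) (A : Finset ℕ) (d : Bool) (i : ℕ) : Prop :=
  (∀ a ∈ openLevels A d (wv w i), closedFrom w a i) ∧
    ∀ k, i ≤ k → doubleAscent w k → closedFrom w (wv w k) (k + 1)

theorem closesFrom_zero_iff (w : Fin (n + 1) → ℕ) :
    closesFrom w ∅ false 0 ↔ hasMatching w := by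
  simp only [closesFrom, openLevels, Finset.filter_empty, Finset.notMem_empty, false_imp_iff,
    implies_true, true_and, Nat.zero_le, true_imp_iff]
  rfl

theorem closesFrom_of_ascent (w : Fin (n + 1) → ℕ) {A : Finset ℕ} {d : Bool} {i : ℕ}
    (hi : i < n) (hlt : wv w i < wv w (i + 1))
    (hd : d = true ↔ 1 ≤ i ∧ wv w (i - 1) < wv w i) :
    closesFrom w A d i ↔ closesFrom w (matchNext (A, d) (wv w i) (wv w (i + 1))).1 true (i + 1) := by
  have hdd : ¬ doubleDescent w i := fun h => absurd h.2.2.2 (by omega)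
  have hda : doubleAscent w i ↔ d = true := by
    rw [hd]
    exact ⟨fun h => ⟨h.1, h.2.2.1⟩, fun h => ⟨h.1, hi, h.2, hlt⟩⟩
  have step : ∀ a, a ≤ wv w i → (closedFrom w a i ↔ closedFrom w a (i + 1)) := fun a ha =>
    closedFrom_succ_iff w ha fun h => hdd h.1
  have later : (∀ k, i ≤ k → doubleAscent w k → closedFrom w (wv w k) (k + 1)) ↔
      (d = true → closedFrom w (wv w i) (i + 1)) ∧
        ∀ k, i + 1 ≤ k → doubleAscent w k → closedFrom w (wv w k) (k + 1) := by
    rw [← hda]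
    refine ⟨fun h => ⟨h i le_rfl, fun k hk => h k (by omega)⟩, fun h k hk => ?_⟩
    rcases hk.eq_or_lt with rfl | hk
    · exact h.1
    · exact h.2 k hk
  rw [closesFrom, closesFrom, later, ← and_assoc]
  refine and_congr_left fun _ => ?_
  simp only [matchNext, if_pos hlt, openLevels]
  cases d with
  | true =>
    simp only [Finset.mem_filter, if_true, Finset.mem_insert]
    constructor
    · rintro ⟨h1, h2⟩ a ⟨rfl | ⟨ha, hap⟩, -⟩
      · exact h2 trivial
      · exact (step a hap.le).1 (h1 a ⟨ha, Or.inl hap⟩)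
    · intro h
      refine ⟨fun a ha => ?_, fun _ => h _ ⟨Or.inl rfl, Or.inl hlt⟩⟩
      have hap : a < wv w i := by simpa using ha.2
      exact (step a hap.le).2 (h a ⟨Or.inr ⟨ha.1, hap⟩, Or.inl (by omega)⟩)
  | false =>
    simp only [Finset.mem_filter, Bool.false_eq_true, if_false, false_imp_iff, and_true, true_and]
    constructor
    · rintro h a ⟨⟨ha, hap⟩, -⟩
      exact (step a hap).1 (h a ⟨ha, by omega⟩)
    · rintro h a ⟨ha, hap⟩
      exact (step a (by omega)).2 (h a ⟨⟨ha, by omega⟩, by omega⟩)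

theorem closesFrom_of_descent (w : Fin (n + 1) → ℕ) {A : Finset ℕ} {d : Bool} {i : ℕ}
    (hi : i < n) (hlt : wv w (i + 1) < wv w i)
    (hd : d = false → 1 ≤ i ∧ wv w i < wv w (i - 1)) :
    closesFrom w A d i ↔
      (∀ a ∈ A, wv w (i + 1) < a → wv w i ≤ a) ∧ closesFrom w A false (i + 1) := by
  have later : (∀ k, i ≤ k → doubleAscent w k → closedFrom w (wv w k) (k + 1)) ↔
      ∀ k, i + 1 ≤ k → doubleAscent w k → closedFrom w (wv w k) (k + 1) := by
    refine ⟨fun h k hk => h k (by omega), fun h k hk hk' => ?_⟩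
    rcases hk.eq_or_lt with rfl | hk
    · exact absurd hk'.2.2.2 (by omega)
    · exact h k hk hk'
  rw [closesFrom, closesFrom, later, ← and_assoc]
  refine and_congr_left fun _ => ?_
  simp only [openLevels, Finset.mem_filter, true_and]
  constructor
  · refine fun h => ⟨fun a ha hu => ?_, fun a ha => ?_⟩
    · by_contra hp
      exact not_closedFrom w hu (by omega) (h a ⟨ha, by omega⟩)
    · exact (closedFrom_succ_iff w (by omega) (by omega)).1 (h a ⟨ha.1, by omega⟩)
  · rintro ⟨h1, h2⟩ a ⟨ha, hap⟩
    rcases hap with hap | ⟨rfl, rfl⟩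
    · have := h1 a ha
      exact (closedFrom_succ_iff w (by omega) (by omega)).2 (h2 a ⟨ha, by omega⟩)
    · exact ⟨i, le_rfl, ⟨(hd rfl).1, hi, (hd rfl).2, hlt⟩, rfl, fun j hj hj' => by omega⟩

theorem card_openLevels_of_ascent (A : Finset ℕ) (d : Bool) {p u : ℕ} (h : p < u) :
    (openLevels (matchNext (A, d) p u).1 true u).card =
      (openLevels A d p).card + if d = true then 1 else 0 := by
  have : openLevels (matchNext (A, d) p u).1 true u =
      if d = true then insert p (openLevels A d p) else openLevels A d p := by
    ext a
    cases d <;> simp [openLevels, matchNext, h] <;> grind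
  rw [this]
  split_ifs with hd
  · rw [Finset.card_insert_of_notMem]
    simp [openLevels, hd]
  · rfl

theorem card_openLevels_of_descent (A : Finset ℕ) (d : Bool) {p u : ℕ} (h : u < p)
    (hA : ∀ a ∈ A, u < a → p ≤ a) :
    (openLevels A d p).card =
      (openLevels A false u).card + if d = false ∧ p ∈ A then 1 else 0 := by
  have : openLevels A d p =
      if d = false ∧ p ∈ A then insert p (openLevels A false u) else openLevels A false u := by
    ext a
    have := hA a
    split_ifs with hd <;> simp only [openLevels, Finset.mem_filter, Finset.mem_insert, true_and]
    · obtain ⟨rfl, hp⟩ := hd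
      constructor
      · rintro ⟨ha, h1 | ⟨-, rfl⟩⟩
        · have := this ha
          exact Or.inr ⟨ha, by omega⟩
        · exact Or.inl rfl
      · rintro (rfl | ⟨ha, h1⟩)
        · exact ⟨hp, Or.inr ⟨rfl, rfl⟩⟩
        · exact ⟨ha, Or.inl (by omega)⟩
    · constructor
      · rintro ⟨ha, h1 | ⟨rfl, rfl⟩⟩
        · have := this ha
          exact ⟨ha, by omega⟩
        · exact absurd ⟨rfl, ha⟩ hd
      · rintro ⟨ha, h1⟩
        exact ⟨ha, Or.inl (by omega)⟩
  rw [this]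
  split_ifs with hd
  · rw [Finset.card_insert_of_notMem]
    simp only [openLevels, Finset.mem_filter, true_and]
    omega
  · rfl

theorem matchWeight_eq (x : R) (w : Fin (n + 1) → ℕ) (hn : wv w n = 0)
    (hw : ∀ i < n, wv w i ≠ wv w (i + 1)) (m i : ℕ) (him : i + m = n) (A : Finset ℕ) (d : Bool)
    (hA : 0 ∉ A) (hd : d = true ↔ 1 ≤ i ∧ wv w (i - 1) < wv w i)
    (hd' : d = false → wv w i = 0 ∨ 1 ≤ i ∧ wv w i < wv w (i - 1)) :
    (closesFrom w A d i → ∃ e, pathWeight (matchStep x) matchNext (wv w) m i (A, d) =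
        x ^ ascFrom w i * (1 + x) ^ e ∧
      e + 2 * ascFrom w i + (openLevels A d (wv w i)).card + (if d = true then 1 else 0) = m) ∧
    (¬ closesFrom w A d i → pathWeight (matchStep x) matchNext (wv w) m i (A, d) = 0) := by
  induction m generalizing i A d with
  | zero =>
    obtain rfl : i = n := him
    have hdf : d = false := by
      rw [← Bool.not_eq_true, hd]
      omega
    have hB : openLevels A d (wv w i) = ∅ := by
      refine Finset.filter_eq_empty_iff.2 fun a ha => ?_
      have : a ≠ 0 := fun h => hA (h ▸ ha)
      omega
    refine ⟨fun _ => ⟨0, by simp [pathWeight, hn, ascFrom_self], by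
      rw [hB]
      simp [hdf, ascFrom_self]⟩, fun h => absurd ⟨by simp [hB], fun k hk hk' => ?_⟩ h⟩
    exact absurd hk'.2.1 (by omega)
  | succ m ih =>
    have hi : i < n := by omega
    rw [pathWeight, ascFrom_eq w hi]
    rcases lt_or_gt_of_ne (hw i hi) with hlt | hlt
    · have hnext : matchNext (A, d) (wv w i) (wv w (i + 1)) =
          ((matchNext (A, d) (wv w i) (wv w (i + 1))).1, true) := by
        simp [matchNext, hlt]
      have hA' : 0 ∉ (matchNext (A, d) (wv w i) (wv w (i + 1))).1 := by
        cases d with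
        | true =>
          have := (hd.1 rfl).2
          simp [matchNext, hlt, hA]
          omega
        | false => simp [matchNext, hlt, hA]
      have IH := ih (i + 1) (by omega) _ true hA' (by simpa using hlt) (by simp)
      rw [← hnext, ← closesFrom_of_ascent w hi hlt hd, card_openLevels_of_ascent A d hlt] at IH
      simp only [matchStep, hlt, if_true] at IH ⊢
      refine ⟨fun h => ?_, fun h => by rw [IH.2 h, mul_zero]⟩
      obtain ⟨e, he, hc⟩ := IH.1 h
      exact ⟨e, by rw [he]; ring, by omega⟩
    · have hnext : matchNext (A, d) (wv w i) (wv w (i + 1)) = (A, false) := by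
        simp [matchNext, hlt.not_gt]
      have hd2 : d = false → 1 ≤ i ∧ wv w i < wv w (i - 1) := fun h =>
        (hd' h).resolve_left (by omega)
      have IH := ih (i + 1) (by omega) A false hA (by simpa using hlt.le)
        (fun _ => Or.inr ⟨by omega, by simpa using hlt⟩)
      rw [hnext, closesFrom_of_descent w hi hlt hd2]
      simp only [matchStep, hlt.not_gt, hlt, if_false, true_and, zero_add]
      by_cases hcl : ∀ a ∈ A, wv w (i + 1) < a → wv w i ≤ a
      · rw [if_pos hcl]
        refine ⟨fun h => ?_, fun h => by rw [IH.2 fun hc => h ⟨hcl, hc⟩, mul_zero]⟩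
        obtain ⟨e, he, hc⟩ := IH.1 h.2
        rw [card_openLevels_of_descent A d hlt hcl, he]
        simp only [Bool.false_eq_true, if_false, add_zero] at hc
        by_cases hp : wv w i ∈ A
        · refine ⟨e, by simp [hp], ?_⟩
          cases d <;> simp [hp] <;> omega
        · cases d with
          | true => exact ⟨e, by simp, by simp; omega⟩
          | false => exact ⟨e + 1, by simp [hp]; ring, by simp [hp]; omega⟩
      · rw [if_neg hcl]
        exact ⟨fun h => absurd h.1 hcl, fun _ => zero_mul _⟩

theorem sum_smirnov_pathWeight {σ : Type*} (τ : σ → ℕ → ℕ → R) (δ : σ → ℕ → ℕ → σ)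
    (hτ : ∀ q p, τ q p p = 0) {r : ℕ} (hr : 0 < r) (q : σ) :
    ∑ w ∈ smirnov n r, pathWeight τ δ (wv w) n 0 q = pathSum τ δ r n q 0 := by
  rw [← sum_pathWeight τ δ n q hr]
  refine Finset.sum_subset (fun w hw => ?_) fun w hw hw' => ?_
  · rw [smirnov, Finset.mem_filter] at hw
    exact Finset.mem_filter.2 ⟨hw.1, hw.2.1⟩
  · rw [Finset.mem_filter] at hw
    refine pathWeight_eq_zero τ δ hτ _ _ _ _ fun h => hw' ?_
    simp only [zero_add] at h
    exact Finset.mem_filter.2 ⟨hw.1, hw.2, h⟩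

theorem matchWeight_word (x : R) {r : ℕ} {w : Fin (n + 1) → ℕ} (hw : w ∈ smirnov n r) :
    (hasMatching w → pathWeight (matchStep x) matchNext (wv w) n 0 (∅, false) =
      x ^ asc w * (1 + x) ^ (n - 2 * asc w) ∧ 2 * asc w ≤ n) ∧
    (¬ hasMatching w → pathWeight (matchStep x) matchNext (wv w) n 0 (∅, false) = 0) := by
  obtain ⟨-, h0, hn, hs⟩ := Finset.mem_filter.1 hw
  have key := matchWeight_eq x w hn hs n 0 (zero_add n) ∅ false (by simp) (by simp)
    (fun _ => Or.inl h0)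
  rw [closesFrom_zero_iff, ascFrom_zero] at key
  refine ⟨fun h => ?_, key.2⟩
  obtain ⟨e, he, hc⟩ := key.1 h
  simp only [openLevels, Finset.filter_empty, Finset.card_empty, Bool.false_eq_true, if_false,
    add_zero] at hc
  refine ⟨?_, by omega⟩
  rw [he, show n - 2 * asc w = e by omega]

theorem ascWeight_word (x : R) (δ : Unit → ℕ → ℕ → Unit) {r : ℕ} {w : Fin (n + 1) → ℕ}
    (hw : w ∈ smirnov n r) : pathWeight (ascStep x) δ (wv w) n 0 () = x ^ asc w := by
  obtain ⟨-, -, hn, hs⟩ := Finset.mem_filter.1 hw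
  rw [ascWeight_eq x δ w hn hs n 0 (zero_add n), ascFrom_zero]

end Words

/-- `γ`-expansion of the ascent polynomial of Smirnov words:
`Σ_{w ∈ S(n,r)} x^{asc w} = Σ_{i=0}^{⌊n/2⌋} ξ_{n,r,i} x^i (1+x)^{n-2i}`, where
`ξ_{n,r,i}` counts the words in `S(n,r)` with exactly `i` ascents having the
matching property. -/
theorem smirnov_ascent_gamma_expansion (n r : ℕ) (hn : 0 < n) (hr : 0 < r) :
    ∑ w ∈ smirnov n r, (Polynomial.X : Polynomial ℤ) ^ asc w =
      ∑ i ∈ Finset.range (n / 2 + 1),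
        (((smirnov n r).filter fun w => asc w = i ∧ hasMatching w).card : Polynomial ℤ) *
          Polynomial.X ^ i * (1 + Polynomial.X) ^ (n - 2 * i) := by
  set x : Polynomial ℤ := Polynomial.X
  have hseries := congrArg (PowerSeries.coeff n) (matchSeries_zero x hr fun _ _ _ => ())
  simp only [pathSeries, PowerSeries.coeff_mk] at hseries
  rw [← sum_smirnov_pathWeight _ _ (by simp [matchStep]) hr,
    ← sum_smirnov_pathWeight _ _ (by simp [ascStep]) hr,
    Finset.sum_congr rfl fun w hw => ascWeight_word x _ hw] at hseries
  rw [← hseries, ← Finset.sum_filter_of_ne (p := hasMatching)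
    fun w hw hne => by_contra fun h => hne ((matchWeight_word x hw).2 h),
    ← Finset.sum_fiberwise_of_maps_to (g := asc) (t := Finset.range (n / 2 + 1))]
  · refine Finset.sum_congr rfl fun i _ => ?_
    rw [Finset.filter_filter, Finset.filter_congr fun w _ => and_comm, mul_assoc, ← nsmul_eq_mul]
    refine Finset.sum_eq_card_nsmul fun w hw => ?_
    obtain ⟨hs, rfl, hm⟩ := Finset.mem_filter.1 hw
    exact ((matchWeight_word x hs).1 hm).1
  · intro w hw
    obtain ⟨hw, hm⟩ := Finset.mem_filter.1 hw
    have := ((matchWeight_word x hw).1 hm).2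
    exact Finset.mem_range.2 (by omega)
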